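/- The third basic cohomology of the Schrödinger-Virasoro conformal algebra with trivial coefficients is one-dimensional: H̃³(SV,ℂ) = ℂΦ, where Φ is the 3-cochain with Φ_{λ₁,λ₂,λ₃}(L,L,L) = (λ₁−λ₂)(λ₁−λ₃)(λ₂−λ₃) and Φ = 0 on all other triples of generators from {L,Y,M}. In particular, Φ is a 3-cocycle that is not a 3-coboundary, and every 3-cocycle is, modulo 3-coboundaries, a scalar multiple of Φ. -/

import Mathlib

/-!
Cochain complex of the Schrödinger–Virasoro conformal algebra
`SV = ℂ[∂]L ⊕ ℂ[∂]Y ⊕ ℂ[∂]M` with coefficients in the trivial module `ℂ_a`.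

Since `SV` is a free `ℂ[∂]`-module on the generators `L, Y, M`, and since a
`q`-cochain (a `ℂ`-linear, conformally antilinear map `SV^{⊗q} → ℂ[λ₁,…,λ_q]`)
is uniquely determined by its values on `q`-tuples of generators, we model
cochains as functions from generator tuples to `ℂ[λ₁,…,λ_q]`, subject to the
skew-symmetry condition (simultaneous permutation of the entries and the
variables `λᵢ`).
-/

namespace SVCA

open MvPolynomial

/-- The generators `L`, `Y`, `M` of the Schrödinger–Virasoro conformal algebra. -/
inductive SVGen : Type
  | L | Y | M
  deriving DecidableEq

open SVGen

/-- The λ-brackets on generators: `SVbrk a b = (x, c₁, c₂)` encodes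
`[a_λ b] = (c₁ ∂ + c₂ λ) x`.  Zero brackets are encoded by zero coefficients:
`[L_λ L] = (∂+2λ)L`, `[L_λ Y] = (∂+(3/2)λ)Y`, `[Y_λ L] = ((1/2)∂+(3/2)λ)Y`,
`[Y_λ Y] = (∂+2λ)M`, `[L_λ M] = (∂+λ)M`, `[M_λ L] = λM`, and
`[Y_λ M] = [M_λ Y] = [M_λ M] = 0`. -/
noncomputable def SVbrk : SVGen → SVGen → SVGen × ℂ × ℂ
  | L, L => (L, 1, 2)
  | L, Y => (Y, 1, 3/2)
  | Y, L => (Y, 1/2, 3/2)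
  | Y, Y => (M, 1, 2)
  | L, M => (M, 1, 1)
  | M, L => (M, 0, 1)
  | _, _ => (M, 0, 0)

/-- The space of (not necessarily skew-symmetric) `q`-cochains with trivial
coefficients: functions from `q`-tuples of generators to `ℂ[λ₁,…,λ_q]`. -/
abbrev SVRaw (q : ℕ) := (Fin q → SVGen) → MvPolynomial (Fin q) ℂ

/-- The `ℂ`-subspace `C̃^q(SV,ℂ)` of `q`-cochains: skew-symmetry with respect to
simultaneous permutations of the arguments and of the variables `λᵢ`. -/
noncomputable def SVCochain (q : ℕ) : Submodule ℂ (SVRaw q) where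
  carrier := {c | ∀ (σ : Equiv.Perm (Fin q)) (a : Fin q → SVGen),
      rename σ (c (a ∘ σ)) = ((Equiv.Perm.sign σ : ℤ) : ℂ) • c a}
  add_mem' := by
    intro c c' hc hc' σ a
    simp only [Pi.add_apply, map_add, hc σ a, hc' σ a, smul_add]
  zero_mem' := by intro σ a; simp
  smul_mem' := by
    intro r c hc σ a
    simp only [Pi.smul_apply, map_smul, hc σ a]
    rw [smul_comm]

/-- The strictly increasing embedding `Fin q → Fin (q+2)` omitting `i` and `j`
(meaningful for `i < j`; junk otherwise). -/
def SVskip {q : ℕ} (i j : Fin (q + 2)) (k : Fin q) : Fin (q + 2) :=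
  j.succAbove ((⟨min (i : ℕ) q, Nat.lt_succ_of_le (Nat.min_le_right _ _)⟩ : Fin (q + 1)).succAbove k)

/-- The `(i,j)`-summand of the differential (trivial coefficients):
`(-1)^{i+j} γ_{λᵢ+λⱼ, λ₁, …, λ̂ᵢ, …, λ̂ⱼ, …}([a_{i λᵢ} a_j], a₁, …, âᵢ, …, âⱼ, …)`,
where `[a_{i λᵢ} a_j] = (c₁∂ + c₂λᵢ)x` and conformal antilinearity in the first
slot (whose variable is `λᵢ+λⱼ`) produces the factor `c₂λᵢ - c₁(λᵢ+λⱼ)`. -/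
noncomputable def SVdTerm {q : ℕ} (c : SVRaw (q + 1)) (a : Fin (q + 2) → SVGen)
    (i j : Fin (q + 2)) : MvPolynomial (Fin (q + 2)) ℂ :=
  ((-1 : ℂ) ^ ((i : ℕ) + (j : ℕ))) •
    ((C (SVbrk (a i) (a j)).2.2 * X i - C (SVbrk (a i) (a j)).2.1 * (X i + X j)) *
      aeval (Fin.cons (X i + X j) fun k => X (SVskip i j k))
        (c (Fin.cons (SVbrk (a i) (a j)).1 fun k => a (SVskip i j k))))

/-- The differential `d_q : C̃^q → C̃^{q+1}` (trivial coefficients). -/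
noncomputable def SVd : {q : ℕ} → SVRaw q → SVRaw (q + 1)
  | 0, _ => 0
  | (q + 1), c => fun a =>
      ∑ i : Fin (q + 2), ∑ j : Fin (q + 2),
        if (i : ℕ) < (j : ℕ) then SVdTerm c a i j else 0

lemma SVdTerm_add {q : ℕ} (c c' : SVRaw (q + 1)) (a : Fin (q + 2) → SVGen)
    (i j : Fin (q + 2)) :
    SVdTerm (c + c') a i j = SVdTerm c a i j + SVdTerm c' a i j := by
  simp [SVdTerm, mul_add, smul_add]

lemma SVdTerm_smul {q : ℕ} (r : ℂ) (c : SVRaw (q + 1)) (a : Fin (q + 2) → SVGen)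
    (i j : Fin (q + 2)) :
    SVdTerm (r • c) a i j = r • SVdTerm c a i j := by
  simp only [SVdTerm, Pi.smul_apply, map_smul, mul_smul_comm]
  rw [smul_comm]

/-- The differential as a `ℂ`-linear map. -/
noncomputable def SVdLin (q : ℕ) : SVRaw q →ₗ[ℂ] SVRaw (q + 1) where
  toFun := SVd
  map_add' c c' := by
    cases q with
    | zero => simp [SVd]
    | succ q =>
      funext a
      simp only [SVd, Pi.add_apply]
      rw [← Finset.sum_add_distrib]
      refine Finset.sum_congr rfl fun i _ => ?_
      rw [← Finset.sum_add_distrib]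
      refine Finset.sum_congr rfl fun j _ => ?_
      by_cases h : (i : ℕ) < (j : ℕ)
      · simp [h, SVdTerm_add]
      · simp [h]
  map_smul' r c := by
    cases q with
    | zero => simp [SVd]
    | succ q =>
      funext a
      simp only [SVd, RingHom.id_apply, Pi.smul_apply, Finset.smul_sum]
      refine Finset.sum_congr rfl fun i _ => ?_
      refine Finset.sum_congr rfl fun j _ => ?_
      by_cases h : (i : ℕ) < (j : ℕ)
      · simp [h, SVdTerm_smul]
      · simp [h]

/-- The space `D̃^q(SV,ℂ)` of `q`-cocycles: skew-symmetric cochains with `dγ = 0`. -/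
noncomputable def SVcocycles (q : ℕ) : Submodule ℂ (SVRaw q) :=
  SVCochain q ⊓ LinearMap.ker (SVdLin q)

/-- The space `B̃^q(SV,ℂ)` of `q`-coboundaries: differentials of `(q-1)`-cochains
(`0` for `q = 0`). -/
noncomputable def SVcoboundaries : (q : ℕ) → Submodule ℂ (SVRaw q)
  | 0 => ⊥
  | (q + 1) => Submodule.map (SVdLin q) (SVCochain q)

/-- The basic cohomology `H̃^q(SV,ℂ)` = cocycles / coboundaries. -/
noncomputable def SVbasicH (q : ℕ) :=
  SVcocycles q ⧸ Submodule.comap (SVcocycles q).subtype (SVcoboundaries q)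


noncomputable instance (q : ℕ) : AddCommGroup (SVbasicH q) := by
  unfold SVbasicH; infer_instance
noncomputable instance (q : ℕ) : Module ℂ (SVbasicH q) := by
  unfold SVbasicH; infer_instance

/-- The action of `∂` on `q`-cochains with coefficients in `ℂ_a`:
`(∂γ)_{λ₁,…,λ_q} = (a + λ₁ + ⋯ + λ_q)·γ_{λ₁,…,λ_q}`.  (The trivial module `ℂ`
is the case `a = 0`.) -/
noncomputable def SVpartial (a : ℂ) (q : ℕ) : SVRaw q →ₗ[ℂ] SVRaw q where
  toFun c := fun t => (C a + ∑ i, X i) * c t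
  map_add' c c' := by funext t; simp [mul_add]
  map_smul' r c := by funext t; simp [mul_smul_comm]

/-- The subspace `∂C̃^q ⊆ C̃^q` (with coefficients in `ℂ_a`). -/
noncomputable def SVpartialSub (a : ℂ) (q : ℕ) : Submodule ℂ (SVRaw q) :=
  Submodule.map (SVpartial a q) (SVCochain q)

/-- `q`-cochains representing reduced `q`-cocycles: cochains `γ` with
`dγ ∈ ∂C̃^{q+1}` (these are exactly the representatives of `ker d̄`
in the quotient complex `C̃^•/∂C̃^•`). -/
noncomputable def SVredCocycles (a : ℂ) (q : ℕ) : Submodule ℂ (SVRaw q) :=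
  SVCochain q ⊓ Submodule.comap (SVdLin q) (SVpartialSub a (q + 1))

/-- `q`-cochains representing reduced `q`-coboundaries: `∂C̃^q + dC̃^{q-1}`
(these are exactly the representatives of `im d̄` in the quotient complex). -/
noncomputable def SVredCoboundaries (a : ℂ) : (q : ℕ) → Submodule ℂ (SVRaw q)
  | 0 => SVpartialSub a 0
  | (q + 1) => SVpartialSub a (q + 1) ⊔ Submodule.map (SVdLin q) (SVCochain q)

/-- The reduced cohomology `H^q(SV,ℂ_a)`, realized (via the third isomorphism
theorem) as `{γ ∈ C̃^q : dγ ∈ ∂C̃^{q+1}} / (∂C̃^q + dC̃^{q-1})`. -/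
noncomputable def SVredH (a : ℂ) (q : ℕ) :=
  SVredCocycles a q ⧸ Submodule.comap (SVredCocycles a q).subtype (SVredCoboundaries a q)


noncomputable instance (a : ℂ) (q : ℕ) : AddCommGroup (SVredH a q) := by
  unfold SVredH; infer_instance
noncomputable instance (a : ℂ) (q : ℕ) : Module ℂ (SVredH a q) := by
  unfold SVredH; infer_instance

/-- The cocycles of the subcomplex `∂C̃^•` (trivial coefficients `ℂ`). -/
noncomputable def SVsubCocycles (q : ℕ) : Submodule ℂ (SVRaw q) :=
  SVpartialSub 0 q ⊓ LinearMap.ker (SVdLin q)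

/-- The coboundaries of the subcomplex `∂C̃^•` (trivial coefficients `ℂ`). -/
noncomputable def SVsubCoboundaries : (q : ℕ) → Submodule ℂ (SVRaw q)
  | 0 => ⊥
  | (q + 1) => Submodule.map (SVdLin q) (SVpartialSub 0 q)

/-- The cohomology `H^q(∂C̃^•)` of the subcomplex `∂C̃^•` (trivial coefficients). -/
noncomputable def SVsubH (q : ℕ) :=
  SVsubCocycles q ⧸ Submodule.comap (SVsubCocycles q).subtype (SVsubCoboundaries q)


noncomputable instance (q : ℕ) : AddCommGroup (SVsubH q) := by
  unfold SVsubH; infer_instance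
noncomputable instance (q : ℕ) : Module ℂ (SVsubH q) := by
  unfold SVsubH; infer_instance

/-- The operator `τ`:
`(τγ)_{λ₁,…,λ_{q-1}}(a₁,…,a_{q-1}) = (-1)^{q-1} ∂/∂λ γ_{λ₁,…,λ_{q-1},λ}(a₁,…,a_{q-1},L)|_{λ=0}`. -/
noncomputable def SVtau {q : ℕ} (c : SVRaw (q + 1)) : SVRaw q := fun a =>
  ((-1 : ℂ) ^ q) •
    aeval (Fin.snoc (fun i : Fin q => X i) 0)
      (pderiv (Fin.last q) (c (Fin.snoc a SVGen.L)))

/-- The operator `τ₂`: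
`(τ₂γ)_{λ₁,…,λ_{q-1}}(a₁,…,a_{q-1}) = (-1)^{q-1} γ_{λ₁,…,λ_{q-1},λ}(a₁,…,a_{q-1},L)|_{λ=0}`. -/
noncomputable def SVtau2 {q : ℕ} (c : SVRaw (q + 1)) : SVRaw q := fun a =>
  ((-1 : ℂ) ^ q) • aeval (Fin.snoc (fun i : Fin q => X i) 0) (c (Fin.snoc a SVGen.L))

/-- The tuple with `k` copies of `L`, then `l` copies of `Y`, then copies of `M`. -/
def SVtuple (q k l : ℕ) : Fin q → SVGen := fun i =>
  if (i : ℕ) < k then SVGen.L else if (i : ℕ) < k + l then SVGen.Y else SVGen.M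

/-- `∏_{i<j ∈ s} (λᵢ - λⱼ)`. -/
noncomputable def SVvandermonde (q : ℕ) (s : Finset (Fin q)) : MvPolynomial (Fin q) ℂ :=
  ∏ p ∈ (s ×ˢ s).filter fun p => p.1 < p.2, (X p.1 - X p.2)

open SVGen in
/-- The `3`-cochain `Φ`, with `Φ_{λ₁,λ₂,λ₃}(L,L,L) = (λ₁-λ₂)(λ₁-λ₃)(λ₂-λ₃)`
and `Φ = 0` on all other triples of generators. -/
noncomputable def SVPhi : SVRaw 3 := fun a =>
  if a = ![L, L, L] then (X 0 - X 1) * (X 0 - X 2) * (X 1 - X 2) else 0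

/-- The conformal weight shift `Δ - 1` of each generator. -/
noncomputable def SVwt : SVGen → ℂ
  | L => 1
  | Y => 1 / 2
  | M => 0

/-- The factor `c₂ x - c₁ (x + y)` by which `[a_x b]` acts in the first slot of a cochain. -/
noncomputable def SVfactor {R : Type*} [CommRing R] [Algebra ℂ R] (a b : SVGen) (x y : R) : R :=
  algebraMap ℂ R (SVbrk a b).2.2 * x - algebraMap ℂ R (SVbrk a b).2.1 * (x + y)

lemma SVbrk_fst_comm (a b : SVGen) : (SVbrk a b).1 = (SVbrk b a).1 := by
  cases a <;> cases b <;> rfl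

lemma SVbrk_L_fst (a : SVGen) : (SVbrk a L).1 = a := by
  cases a <;> rfl

section Tuples

variable {T : Type*}

lemma cons_SVskip_one (f : Fin 3 → T) (s : T) (i j : Fin 3) :
    (Fin.cons s fun k => f (SVskip (q := 1) i j k) : Fin 2 → T) = ![s, f (SVskip i j 0)] := by
  funext k; fin_cases k <;> rfl

lemma cons_SVskip_two (f : Fin 4 → T) (s : T) (i j : Fin 4) :
    (Fin.cons s fun k => f (SVskip (q := 2) i j k) : Fin 3 → T) =
      ![s, f (SVskip i j 0), f (SVskip i j 1)] := by
  funext k; fin_cases k <;> rfl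

lemma comp_swap_two (f : Fin 2 → T) : f ∘ Equiv.swap (0 : Fin 2) 1 = ![f 1, f 0] := by
  funext k; fin_cases k <;> rfl

lemma comp_swap_three_left (f : Fin 3 → T) :
    f ∘ Equiv.swap (0 : Fin 3) 1 = ![f 1, f 0, f 2] := by
  funext k; fin_cases k <;> rfl

lemma comp_swap_three_right (f : Fin 3 → T) :
    f ∘ Equiv.swap (1 : Fin 3) 2 = ![f 0, f 2, f 1] := by
  funext k; fin_cases k <;> rfl

lemma eq_vec_two (f : Fin 2 → T) : f = ![f 0, f 1] := by
  funext k; fin_cases k <;> rfl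

lemma eq_vec_three (f : Fin 3 → T) : f = ![f 0, f 1, f 2] := by
  funext k; fin_cases k <;> rfl

lemma eq_vec_four (f : Fin 4 → T) : f = ![f 0, f 1, f 2, f 3] := by
  funext k; fin_cases k <;> rfl

end Tuples

section Factor

variable {R : Type*} [CommRing R] [Algebra ℂ R]

lemma SVfactor_swap (a b : SVGen) (x y : R) : SVfactor b a y x = -SVfactor a b x y := by
  have h : algebraMap ℂ R (1 / 2) + algebraMap ℂ R 1 = algebraMap ℂ R (3 / 2) := by
    rw [← map_add]; norm_num
  have h2 : algebraMap ℂ R 2 = 2 := map_ofNat _ 2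
  cases a <;> cases b <;> simp only [SVfactor, SVbrk, ← h, h2, map_one, map_zero] <;> ring

lemma SVfactor_L (a : SVGen) (x y : R) :
    SVfactor a L x y = x - algebraMap ℂ R (SVwt a) * y := by
  have h : algebraMap ℂ R (1 / 2) + algebraMap ℂ R 1 = algebraMap ℂ R (3 / 2) := by
    rw [← map_add]; norm_num
  have h2 : algebraMap ℂ R 2 = 2 := map_ofNat _ 2
  cases a <;> simp only [SVfactor, SVbrk, SVwt, ← h, h2, map_one, map_zero] <;> ring

lemma aeval_SVdTerm {q : ℕ} (c : SVRaw (q + 1)) (a : Fin (q + 2) → SVGen) (i j : Fin (q + 2))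
    (v : Fin (q + 2) → R) :
    aeval v (SVdTerm c a i j) = (-1) ^ ((i : ℕ) + (j : ℕ)) *
      (SVfactor (a i) (a j) (v i) (v j) *
        aeval (Fin.cons (v i + v j) fun k => v (SVskip i j k) : Fin (q + 1) → R)
          (c (Fin.cons (SVbrk (a i) (a j)).1 fun k => a (SVskip i j k)))) := by
  have h : (fun k => aeval v ((Fin.cons (X i + X j) fun k => X (SVskip i j k) :
      Fin (q + 1) → MvPolynomial (Fin (q + 2)) ℂ) k)) =
      (Fin.cons (v i + v j) fun k => v (SVskip i j k) : Fin (q + 1) → R) := by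
    funext k
    refine Fin.cases ?_ (fun k => ?_) k <;> simp
  rw [SVdTerm, map_smul, map_mul, comp_aeval_apply, h, Algebra.smul_def]
  simp [SVfactor]

lemma aeval_SVd_two (c : SVRaw 2) (a₀ a₁ a₂ : SVGen) (x y z : R) :
    aeval ![x, y, z] (SVd c ![a₀, a₁, a₂]) =
      -(SVfactor a₀ a₁ x y * aeval ![x + y, z] (c ![(SVbrk a₀ a₁).1, a₂])) +
      SVfactor a₀ a₂ x z * aeval ![x + z, y] (c ![(SVbrk a₀ a₂).1, a₁]) -
      SVfactor a₁ a₂ y z * aeval ![y + z, x] (c ![(SVbrk a₁ a₂).1, a₀]) := by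
  have s1 : SVskip (q := 1) 0 1 0 = 2 := by decide
  have s2 : SVskip (q := 1) 0 2 0 = 1 := by decide
  have s3 : SVskip (q := 1) 1 2 0 = 0 := by decide
  change aeval _ (∑ i : Fin 3, ∑ j : Fin 3,
    if (i : ℕ) < (j : ℕ) then SVdTerm (q := 1) c ![a₀, a₁, a₂] i j else 0) = _
  simp only [Fin.sum_univ_three, map_add]
  simp [aeval_SVdTerm, cons_SVskip_one, s1, s2, s3, -coe_aeval_eq_eval]
  ring

lemma aeval_SVd_three (c : SVRaw 3) (a₀ a₁ a₂ a₃ : SVGen) (x y z t : R) :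
    aeval ![x, y, z, t] (SVd c ![a₀, a₁, a₂, a₃]) =
      -(SVfactor a₀ a₁ x y * aeval ![x + y, z, t] (c ![(SVbrk a₀ a₁).1, a₂, a₃])) +
      SVfactor a₀ a₂ x z * aeval ![x + z, y, t] (c ![(SVbrk a₀ a₂).1, a₁, a₃]) -
      SVfactor a₀ a₃ x t * aeval ![x + t, y, z] (c ![(SVbrk a₀ a₃).1, a₁, a₂]) -
      SVfactor a₁ a₂ y z * aeval ![y + z, x, t] (c ![(SVbrk a₁ a₂).1, a₀, a₃]) +
      SVfactor a₁ a₃ y t * aeval ![y + t, x, z] (c ![(SVbrk a₁ a₃).1, a₀, a₂]) -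
      SVfactor a₂ a₃ z t * aeval ![z + t, x, y] (c ![(SVbrk a₂ a₃).1, a₀, a₁]) := by
  have s1 : SVskip (q := 2) 0 1 0 = 2 ∧ SVskip (q := 2) 0 1 1 = 3 := by decide
  have s2 : SVskip (q := 2) 0 2 0 = 1 ∧ SVskip (q := 2) 0 2 1 = 3 := by decide
  have s3 : SVskip (q := 2) 0 3 0 = 1 ∧ SVskip (q := 2) 0 3 1 = 2 := by decide
  have s4 : SVskip (q := 2) 1 2 0 = 0 ∧ SVskip (q := 2) 1 2 1 = 3 := by decide
  have s5 : SVskip (q := 2) 1 3 0 = 0 ∧ SVskip (q := 2) 1 3 1 = 2 := by decide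
  have s6 : SVskip (q := 2) 2 3 0 = 0 ∧ SVskip (q := 2) 2 3 1 = 1 := by decide
  change aeval _ (∑ i : Fin 4, ∑ j : Fin 4,
    if (i : ℕ) < (j : ℕ) then SVdTerm (q := 2) c ![a₀, a₁, a₂, a₃] i j else 0) = _
  simp only [Fin.sum_univ_four, map_add]
  simp [aeval_SVdTerm, cons_SVskip_two, -coe_aeval_eq_eval, s1, s2, s3, s4, s5, s6]
  ring

/-! ### Skew-symmetry in terms of adjacent transpositions -/

lemma SVCochain.aeval_comp {q : ℕ} {c : SVRaw q} (hc : c ∈ SVCochain q) (σ : Equiv.Perm (Fin q))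
    (a : Fin q → SVGen) (v : Fin q → R) :
    aeval (v ∘ σ) (c (a ∘ σ)) = ((Equiv.Perm.sign σ : ℤ) : R) * aeval v (c a) := by
  have h := congrArg (aeval v) (hc σ a)
  rw [aeval_rename, map_smul, Algebra.smul_def] at h
  simpa using h

lemma SVCochain.aeval_swap_two {c : SVRaw 2} (hc : c ∈ SVCochain 2) (a b : SVGen) (x y : R) :
    aeval ![y, x] (c ![b, a]) = -aeval ![x, y] (c ![a, b]) := by
  simpa [comp_swap_two, -coe_aeval_eq_eval] using
    SVCochain.aeval_comp hc (Equiv.swap 0 1) ![a, b] ![x, y]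

lemma SVCochain.aeval_swap_left {c : SVRaw 3} (hc : c ∈ SVCochain 3) (a b d : SVGen) (x y z : R) :
    aeval ![y, x, z] (c ![b, a, d]) = -aeval ![x, y, z] (c ![a, b, d]) := by
  simpa [comp_swap_three_left, -coe_aeval_eq_eval] using
    SVCochain.aeval_comp hc (Equiv.swap 0 1) ![a, b, d] ![x, y, z]

lemma SVCochain.aeval_swap_right {c : SVRaw 3} (hc : c ∈ SVCochain 3) (a b d : SVGen) (x y z : R) :
    aeval ![x, z, y] (c ![a, d, b]) = -aeval ![x, y, z] (c ![a, b, d]) := by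
  simpa [comp_swap_three_right, -coe_aeval_eq_eval] using
    SVCochain.aeval_comp hc (Equiv.swap 1 2) ![a, b, d] ![x, y, z]

end Factor

lemma ext_aeval_two {p r : MvPolynomial (Fin 2) ℂ}
    (h : ∀ x y : ℂ, aeval ![x, y] p = aeval ![x, y] r) : p = r := by
  refine MvPolynomial.funext fun v => ?_
  simpa [← eq_vec_two v, aeval_eq_eval] using h (v 0) (v 1)

lemma ext_aeval_three {p r : MvPolynomial (Fin 3) ℂ}
    (h : ∀ x y z : ℂ, aeval ![x, y, z] p = aeval ![x, y, z] r) : p = r := by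
  refine MvPolynomial.funext fun v => ?_
  simpa [← eq_vec_three v, aeval_eq_eval] using h (v 0) (v 1) (v 2)

lemma ext_aeval_four {p r : MvPolynomial (Fin 4) ℂ}
    (h : ∀ x y z t : ℂ, aeval ![x, y, z, t] p = aeval ![x, y, z, t] r) : p = r := by
  refine MvPolynomial.funext fun v => ?_
  simpa [← eq_vec_four v, aeval_eq_eval] using h (v 0) (v 1) (v 2) (v 3)

lemma mem_SVCochain_of_swap {n : ℕ} {c : SVRaw (n + 1)}
    (h : ∀ (i : Fin n) (a : Fin (n + 1) → SVGen),
      rename (Equiv.swap i.castSucc i.succ) (c (a ∘ Equiv.swap i.castSucc i.succ)) = -c a) :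
    c ∈ SVCochain (n + 1) := by
  intro σ
  have hσ : σ ∈ Submonoid.closure
      (Set.range fun i : Fin n => Equiv.swap i.castSucc i.succ) := by
    rw [Equiv.Perm.mclosure_swap_castSucc_succ]; trivial
  induction hσ using Submonoid.closure_induction with
  | mem σ hσ =>
    obtain ⟨i, rfl⟩ := hσ
    intro a
    simp [h i a, Equiv.Perm.sign_swap (Fin.castSucc_lt_succ (i := i)).ne]
  | one =>
    intro a
    simp
  | mul σ τ _ _ hσ hτ =>
    intro a
    have := hτ (a ∘ σ)
    rw [Equiv.Perm.coe_mul, ← rename_rename, ← Function.comp_assoc, this, map_smul, hσ a, smul_smul]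
    simp [mul_comm]

lemma mem_SVCochain_two {c : SVRaw 2}
    (h : ∀ (a b : SVGen) (x y : ℂ), aeval ![y, x] (c ![b, a]) = -aeval ![x, y] (c ![a, b])) :
    c ∈ SVCochain 2 := by
  refine mem_SVCochain_of_swap fun i a => ext_aeval_two fun x y => ?_
  fin_cases i
  rw [aeval_rename, map_neg]
  have := h (a 0) (a 1) x y
  rw [← eq_vec_two a] at this
  simpa [comp_swap_two, -coe_aeval_eq_eval] using this

lemma mem_SVCochain_three {c : SVRaw 3}
    (h₁ : ∀ (a b d : SVGen) (x y z : ℂ),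
      aeval ![y, x, z] (c ![b, a, d]) = -aeval ![x, y, z] (c ![a, b, d]))
    (h₂ : ∀ (a b d : SVGen) (x y z : ℂ),
      aeval ![x, z, y] (c ![a, d, b]) = -aeval ![x, y, z] (c ![a, b, d])) :
    c ∈ SVCochain 3 := by
  refine mem_SVCochain_of_swap fun i a => ext_aeval_three fun x y z => ?_
  fin_cases i
  · rw [aeval_rename, map_neg]
    have := h₁ (a 0) (a 1) (a 2) x y z
    rw [← eq_vec_three a] at this
    simpa [comp_swap_three_left, -coe_aeval_eq_eval] using this
  · rw [aeval_rename, map_neg]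
    have := h₂ (a 0) (a 1) (a 2) x y z
    rw [← eq_vec_three a] at this
    simpa [comp_swap_three_right, -coe_aeval_eq_eval] using this

lemma SVd_mem_SVCochain_three (c : SVRaw 2) : SVd c ∈ SVCochain 3 := by
  refine mem_SVCochain_three (fun a b d x y z => ?_) fun a b d x y z => ?_
  · rw [aeval_SVd_two, aeval_SVd_two, SVfactor_swap a b, SVbrk_fst_comm b a, add_comm y x]
    ring
  · rw [aeval_SVd_two, aeval_SVd_two, SVfactor_swap b d, SVbrk_fst_comm d b, add_comm z y]
    ring

/-- A `3`-cochain vanishes as soon as it vanishes on ordered triples of generators. -/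
lemma SVCochain.eq_zero_of_sorted {c : SVRaw 3} (hc : c ∈ SVCochain 3)
    (hLLL : c ![L, L, L] = 0) (hLLY : c ![L, L, Y] = 0) (hLLM : c ![L, L, M] = 0)
    (hLYY : c ![L, Y, Y] = 0) (hLYM : c ![L, Y, M] = 0) (hLMM : c ![L, M, M] = 0)
    (hYYY : c ![Y, Y, Y] = 0) (hYYM : c ![Y, Y, M] = 0) (hYMM : c ![Y, M, M] = 0)
    (hMMM : c ![M, M, M] = 0) : c = 0 := by
  have h₁ (a b d : SVGen) (h : c ![a, b, d] = 0) : c ![b, a, d] = 0 :=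
    ext_aeval_three fun x y z => by
      rw [SVCochain.aeval_swap_left hc a b d y x z, h]; simp
  have h₂ (a b d : SVGen) (h : c ![a, b, d] = 0) : c ![a, d, b] = 0 :=
    ext_aeval_three fun x y z => by
      rw [SVCochain.aeval_swap_right hc a b d x z y, h]; simp
  have h (a b d : SVGen) : c ![a, b, d] = 0 := by
    cases a <;> cases b <;> cases d <;> first
      | assumption
      | (apply h₁; assumption)
      | (apply h₂; assumption)
      | (apply h₁; apply h₂; assumption)
      | (apply h₂; apply h₁; assumption)
      | (apply h₁; apply h₂; apply h₁; assumption)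
  funext a
  rw [eq_vec_three a, h]; rfl

/-! ### Rescaling homogeneous components -/

section Scale

variable {σ τ : Type*}

/-- The linear map multiplying the degree `n` component of a polynomial by `f n`. -/
noncomputable def degScale (f : ℕ → ℂ) : MvPolynomial σ ℂ →ₗ[ℂ] MvPolynomial σ ℂ :=
  (basisMonomials σ ℂ).constr ℂ fun m => f m.degree • monomial m 1

lemma degScale_monomial (f : ℕ → ℂ) (m : σ →₀ ℕ) (r : ℂ) :
    degScale f (monomial m r) = f m.degree • monomial m r := by
  have h : degScale f (monomial m 1) = f m.degree • monomial m 1 := by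
    simpa [degScale] using
      (basisMonomials σ ℂ).constr_basis ℂ (fun m => f m.degree • monomial m (1 : ℂ)) m
  rw [← mul_one r, ← smul_eq_mul, ← smul_monomial, map_smul, h, smul_comm]

lemma coeff_degScale (f : ℕ → ℂ) (m : σ →₀ ℕ) (p : MvPolynomial σ ℂ) :
    coeff m (degScale f p) = f m.degree * coeff m p := by
  classical
  induction p using MvPolynomial.induction_on' with
  | monomial u a =>
    rw [degScale_monomial, coeff_smul, coeff_monomial]
    split_ifs with h <;> simp [h]
  | add p r hp hr => rw [map_add, coeff_add, coeff_add, hp, hr, mul_add]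

lemma degScale_of_isHomogeneous (f : ℕ → ℂ) {p : MvPolynomial σ ℂ} {n : ℕ}
    (hp : p.IsHomogeneous n) : degScale f p = f n • p := by
  ext m
  rw [coeff_degScale, coeff_smul, smul_eq_mul]
  by_cases h : coeff m p = 0
  · simp [h]
  · have hm : m.degree = n := by
      rw [Finsupp.degree_eq_weight_one]
      exact hp h
    rw [hm]

lemma degScale_rename (f : ℕ → ℂ) (e : σ → τ) (p : MvPolynomial σ ℂ) :
    degScale f (rename e p) = rename e (degScale f p) := by
  induction p using MvPolynomial.induction_on' with
  | monomial u a =>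
    rw [degScale_monomial, map_smul,
      degScale_of_isHomogeneous f ((isHomogeneous_monomial a rfl).rename_isHomogeneous)]
  | add p r hp hr => simp only [map_add, hp, hr]

lemma degScale_mul_aeval (f : ℕ → ℂ) {l : MvPolynomial τ ℂ} (hl : l.IsHomogeneous 1)
    {v : σ → MvPolynomial τ ℂ} (hv : ∀ i, (v i).IsHomogeneous 1) (p : MvPolynomial σ ℂ) :
    degScale f (l * aeval v p) = l * aeval v (degScale (fun n => f (n + 1)) p) := by
  induction p using MvPolynomial.induction_on' with
  | monomial u a =>
    have h := hl.mul ((isHomogeneous_monomial (d := u) a rfl).aeval v hv)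
    rw [degScale_of_isHomogeneous f h, degScale_monomial, map_smul, mul_smul_comm, one_mul,
      add_comm]
  | add p r hp hr => simp only [map_add, mul_add, hp, hr]

lemma isHomogeneous_degScale {f : ℕ → ℂ} {n : ℕ} (h : ∀ m, m ≠ n → f m = 0)
    (p : MvPolynomial σ ℂ) : (degScale f p).IsHomogeneous n := by
  intro m hm
  by_contra hn
  change (Finsupp.weight fun _ => 1) m ≠ n at hn
  rw [← Finsupp.degree_eq_weight_one] at hn
  exact hm (by rw [coeff_degScale, h _ hn, zero_mul])

lemma degScale_eq_zero {f : ℕ → ℂ} (h : ∀ m, f m = 0) (p : MvPolynomial σ ℂ) :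
    degScale f p = 0 := by
  ext m
  rw [coeff_degScale, h, zero_mul, coeff_zero]

lemma degScale_sub_eq_euler [Fintype σ] (w : ℂ) (p : MvPolynomial σ ℂ) :
    degScale (fun n => n - w) p = ∑ i, X i * pderiv i p - w • p := by
  induction p using MvPolynomial.induction_on' with
  | monomial u a =>
    rw [(isHomogeneous_monomial a rfl).sum_X_mul_pderiv, degScale_monomial, sub_smul,
      Nat.cast_smul_eq_nsmul]
  | add p r hp hr =>
    simp only [map_add, hp, hr, mul_add, Finset.sum_add_distrib, smul_add]
    abel

end Scale

/-- The operator multiplying, in the value at `a`, the component of degree `n` by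
`f (n - ∑ k, SVwt (a k))`. -/
noncomputable def SVscale (f : ℂ → ℂ) {q : ℕ} (c : SVRaw q) : SVRaw q := fun a =>
  degScale (fun n => f (n - ∑ k, SVwt (a k))) (c a)

lemma SVscale_mem_SVCochain (f : ℂ → ℂ) {q : ℕ} {c : SVRaw q} (hc : c ∈ SVCochain q) :
    SVscale f c ∈ SVCochain q := by
  intro σ a
  have hw : ∑ k, SVwt ((a ∘ σ) k) = ∑ k, SVwt (a k) := Equiv.sum_comp σ fun k => SVwt (a k)
  rw [SVscale, SVscale, hw, ← degScale_rename, hc σ a, map_smul]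

lemma SVscale_scale (f g : ℂ → ℂ) {q : ℕ} (c : SVRaw q) :
    SVscale f (SVscale g c) = SVscale (fun x => f x * g x) c := by
  funext a
  ext m
  simp only [SVscale, coeff_degScale, mul_assoc]

lemma SVscale_add_scale {f g : ℂ → ℂ} (h : ∀ x, f x + g x = 1) {q : ℕ} (c : SVRaw q) :
    SVscale f c + SVscale g c = c := by
  funext a
  ext m
  simp only [SVscale, Pi.add_apply, coeff_add, coeff_degScale, ← add_mul, h, one_mul]

lemma sum_eq_add_sum_SVskip {A : Type*} [AddCommMonoid A] {q : ℕ} (g : Fin (q + 2) → A)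
    {i j : Fin (q + 2)} (hij : (i : ℕ) < j) :
    ∑ k, g k = g i + g j + ∑ k, g (SVskip i j k) := by
  have hi : j.succAbove ⟨min (i : ℕ) q, Nat.lt_succ_of_le (Nat.min_le_right _ _)⟩ = i := by
    have : min (i : ℕ) q = i := by omega
    ext
    simp [Fin.succAbove, Fin.lt_def, this, hij]
  rw [Fin.sum_univ_succAbove g j, Fin.sum_univ_succAbove (fun k => g (j.succAbove k))
    ⟨min (i : ℕ) q, Nat.lt_succ_of_le (Nat.min_le_right _ _)⟩, hi, ← add_assoc, add_comm (g j)]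
  rfl

lemma SVbrk_eq_zero_or_wt (a b : SVGen) :
    (SVbrk a b).2 = 0 ∨ SVwt a + SVwt b = SVwt (SVbrk a b).1 + 1 := by
  cases a <;> cases b <;> simp [SVbrk, SVwt] <;> norm_num

lemma SVscale_dTerm (f : ℂ → ℂ) {q : ℕ} (c : SVRaw (q + 1)) (a : Fin (q + 2) → SVGen)
    {i j : Fin (q + 2)} (hij : (i : ℕ) < j) :
    degScale (fun n => f (n - ∑ k, SVwt (a k))) (SVdTerm c a i j) =
      SVdTerm (SVscale f c) a i j := by
  rw [SVdTerm, SVdTerm, map_smul]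
  congr 1
  rcases SVbrk_eq_zero_or_wt (a i) (a j) with h | h
  · simp [h]
  · rw [degScale_mul_aeval]
    · congr 2
      simp only [SVscale]
      congr 2
      funext n
      rw [sum_eq_add_sum_SVskip (fun k => SVwt (a k)) hij, h, Fin.sum_univ_succ]
      simp only [Fin.cons_zero, Fin.cons_succ]
      congr 1
      push_cast
      ring
    · exact (isHomogeneous_C_mul_X _ _).sub
        (by simpa [mul_add] using (isHomogeneous_C_mul_X _ _).add (isHomogeneous_C_mul_X _ _))
    · intro k
      refine Fin.cases ?_ (fun k => ?_) k
      · simpa using (isHomogeneous_X ℂ _).add (isHomogeneous_X ℂ _)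
      · simpa using isHomogeneous_X ℂ _

lemma SVscale_d (f : ℂ → ℂ) {q : ℕ} (c : SVRaw (q + 1)) :
    SVscale f (SVd c) = SVd (SVscale f c) := by
  funext a
  rw [SVscale, SVd, SVd, map_sum]
  refine Finset.sum_congr rfl fun i _ => ?_
  rw [map_sum]
  refine Finset.sum_congr rfl fun j _ => ?_
  split_ifs with hij
  · exact SVscale_dTerm f c a hij
  · exact map_zero _

/-! ### The homotopy given by `SVtau` -/

lemma aeval_dualNumber {n : ℕ} (v w : Fin n → ℂ) (p : MvPolynomial (Fin n) ℂ) :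
    aeval (fun i => (TrivSqZeroExt.inl (v i) + TrivSqZeroExt.inr (w i) : DualNumber ℂ)) p =
      TrivSqZeroExt.inl (aeval v p) +
        TrivSqZeroExt.inr (∑ i, w i * aeval v (pderiv i p)) := by
  induction p using MvPolynomial.induction_on with
  | C a =>
    simp
    rfl
  | add p r hp hr =>
    simp only [map_add, hp, hr, mul_add, Finset.sum_add_distrib, TrivSqZeroExt.inl_add,
      TrivSqZeroExt.inr_add]
    abel
  | mul_X p i hp =>
    rw [map_mul, hp, aeval_X]
    ext
    · simp
    · simp [Derivation.leibniz, pderiv_X, Pi.single_apply, mul_add, Finset.sum_add_distrib,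
        apply_ite]
      rw [add_comm, Finset.sum_mul]
      congr 1
      exact Finset.sum_congr rfl fun j _ => by ring

open TrivSqZeroExt in
lemma aeval_dualNumber_three (x y z x' y' z' : ℂ) (p : MvPolynomial (Fin 3) ℂ) :
    aeval ![(inl x + inr x' : DualNumber ℂ), inl y + inr y', inl z + inr z'] p =
      inl (aeval ![x, y, z] p) + inr (x' * aeval ![x, y, z] (pderiv 0 p) +
        y' * aeval ![x, y, z] (pderiv 1 p) + z' * aeval ![x, y, z] (pderiv 2 p)) := by
  have h := aeval_dualNumber ![x, y, z] ![x', y', z'] p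
  rw [Fin.sum_univ_three] at h
  refine Eq.trans ?_ h
  congr 2
  funext i
  fin_cases i <;> rfl

open TrivSqZeroExt in
lemma SVfactor_inl (a b : SVGen) (x y : ℂ) :
    (SVfactor a b (inl x) (inl y) : DualNumber ℂ) = inl (SVfactor a b x y) := by
  have h (r : ℂ) : algebraMap ℂ (DualNumber ℂ) r = inl r := rfl
  simp only [SVfactor, h, ← inl_mul, ← inl_add, ← inl_sub, Algebra.algebraMap_self,
    RingHom.id_apply]

open TrivSqZeroExt in
lemma SVfactor_L_inr (a : SVGen) (x : ℂ) :
    (SVfactor a L (inl x) (inr 1) : DualNumber ℂ) = inl x - inr (SVwt a) := by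
  have h (r : ℂ) : algebraMap ℂ (DualNumber ℂ) r = inl r := rfl
  rw [SVfactor_L, h, inl_mul_inr, smul_eq_mul, mul_one]

open TrivSqZeroExt in
lemma aeval_SVtau (c : SVRaw 3) (a b : SVGen) (x y : ℂ) :
    aeval ![x, y] (SVtau c ![a, b]) =
      snd (aeval ![(inl x : DualNumber ℂ), inl y, inr 1] (c ![a, b, L])) := by
  have h := aeval_dualNumber_three x y 0 0 0 1 (c ![a, b, L])
  simp only [inr_zero, add_zero, inl_zero, zero_add, zero_mul, one_mul] at h
  have hs : (Fin.snoc ![a, b] L : Fin 3 → SVGen) = ![a, b, L] := by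
    funext k; fin_cases k <;> rfl
  have hv : (fun k => aeval ![x, y] ((Fin.snoc (fun i : Fin 2 => X i) 0 :
      Fin 3 → MvPolynomial (Fin 2) ℂ) k)) = ![x, y, 0] := by
    funext k
    fin_cases k
    · simp [Fin.snoc]
    · simp [Fin.snoc]
    · simp [Fin.snoc]
  rw [h, SVtau, hs, map_smul, comp_aeval_apply, hv]
  simp [Fin.last]

open TrivSqZeroExt in
lemma SVtau_mem_SVCochain {c : SVRaw 3} (hc : c ∈ SVCochain 3) : SVtau c ∈ SVCochain 2 := by
  refine mem_SVCochain_two fun a b x y => ?_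
  rw [aeval_SVtau, aeval_SVtau, SVCochain.aeval_swap_left hc, snd_neg]

open TrivSqZeroExt in
/-- On cocycles, `SVd ∘ SVtau` multiplies the component of degree `n` of the value at `a`
by `n - ∑ k, SVwt (a k)`. -/
lemma SVd_SVtau {c : SVRaw 3} (hc : c ∈ SVCochain 3) (hd : SVd c = 0) :
    SVd (SVtau c) = SVscale id c := by
  funext s
  obtain ⟨a, b, d, rfl⟩ : ∃ a b d, s = ![a, b, d] := ⟨_, _, _, eq_vec_three s⟩
  refine ext_aeval_three fun x y z => ?_
  have h := aeval_SVd_three c a b d L (inl x : DualNumber ℂ) (inl y) (inl z) (inr 1)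
  have h₀ := aeval_dualNumber_three x y z 1 0 0 (c ![a, b, d])
  have h₁ := aeval_dualNumber_three x y z 0 1 0 (c ![a, b, d])
  have h₂ := aeval_dualNumber_three x y z 0 0 1 (c ![a, b, d])
  rw [hd] at h
  simp only [inr_zero, add_zero, zero_add, zero_mul, one_mul] at h₀ h₁ h₂
  rw [SVbrk_L_fst, SVbrk_L_fst, SVbrk_L_fst, SVCochain.aeval_swap_left hc a b d,
    SVCochain.aeval_swap_left hc a d b, SVCochain.aeval_swap_right hc a b d, h₀, h₁, h₂] at h
  have hval := congrArg snd h
  simp only [SVfactor_inl, SVfactor_L_inr, ← inl_add, snd_add, snd_sub, snd_neg,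
    snd_mul, fst_inl, snd_inl, fst_sub, fst_inr, snd_inr, fst_add, fst_neg, smul_eq_mul,
    MulOpposite.smul_eq_mul_unop, MulOpposite.unop_op] at hval
  rw [aeval_SVd_two, aeval_SVtau, aeval_SVtau, aeval_SVtau, SVscale]
  simp only [id, degScale_sub_eq_euler, Fin.sum_univ_three, map_add, map_sub, map_mul,
    map_smul, aeval_X]
  simp [-coe_aeval_eq_eval] at hval ⊢
  linear_combination -hval

/-! ### Cochains of weight zero -/

lemma exists_aeval_eq_of_isHomogeneous {n : ℕ} {p : MvPolynomial (Fin 3) ℂ}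
    (hp : p.IsHomogeneous n) :
    ∃ c : ℕ → ℕ → ℂ, ∀ x y z : ℂ, aeval ![x, y, z] p =
      ∑ i ∈ Finset.range (n + 1), ∑ j ∈ Finset.range (n + 1 - i),
        c i j * (x ^ i * y ^ j * z ^ (n - i - j)) := by
  have hdeg (m : Fin 3 →₀ ℕ) (hm : m ∈ p.support) : m 0 + m 1 + m 2 = n := by
    rw [← hp (mem_support_iff.mp hm)]
    change _ = Finsupp.weight (fun _ => 1) m
    rw [← Finsupp.degree_eq_weight_one, Finsupp.degree_eq_sum, Fin.sum_univ_three]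
  refine ⟨fun i j => coeff (Finsupp.equivFunOnFinite.symm ![i, j, n - i - j]) p, fun x y z => ?_⟩
  rw [Finset.sum_sigma', aeval_eq_eval, eval_eq']
  have key (m : Fin 3 →₀ ℕ) (hm : m ∈ p.support) :
      Finsupp.equivFunOnFinite.symm ![m 0, m 1, n - m 0 - m 1] = m := by
    have := hdeg m hm
    ext k
    fin_cases k
    · rfl
    · rfl
    · change n - m 0 - m 1 = m 2
      omega
  refine Finset.sum_of_injOn (fun m => ⟨m 0, m 1⟩) ?_ ?_ ?_ ?_
  · intro m hm m' hm' h
    simp only [Sigma.mk.injEq, heq_eq_eq] at h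
    rw [← key m hm, ← key m' hm', h.1, h.2]
  · intro m hm
    have := hdeg m hm
    simp only [Finset.coe_sigma, Set.mem_sigma_iff, Finset.coe_range, Set.mem_Iio]
    omega
  · rintro ⟨i, j⟩ - h
    by_cases h0 : coeff (Finsupp.equivFunOnFinite.symm ![i, j, n - i - j]) p = 0
    · simp [h0]
    · exact absurd ⟨_, mem_support_iff.mpr h0, rfl⟩ h
  · intro m hm
    have := hdeg m hm
    simp only [key m hm, Fin.prod_univ_three]
    have h2 : m 2 = n - m 0 - m 1 := by omega
    simp [h2]

lemma aeval_of_alternating_cubic {p : MvPolynomial (Fin 3) ℂ} (hp : p.IsHomogeneous 3)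
    (h₁ : ∀ x y z : ℂ, aeval ![y, x, z] p = -aeval ![x, y, z] p)
    (h₂ : ∀ x y z : ℂ, aeval ![x, z, y] p = -aeval ![x, y, z] p) :
    ∃ r : ℂ, ∀ x y z : ℂ, aeval ![x, y, z] p = r * ((x - y) * (x - z) * (y - z)) := by
  obtain ⟨c, hc⟩ := exists_aeval_eq_of_isHomogeneous hp
  simp only [hc, Finset.sum_range_succ, Finset.sum_range_zero] at h₁ h₂ ⊢
  refine ⟨c 2 1, fun x y z => ?_⟩
  have := h₁ 1 0 0
  have := h₁ 0 0 1
  have := h₁ 1 1 0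
  have := h₁ 1 0 1
  have := h₁ 1 0 (-1)
  have := h₁ 1 1 1
  have := h₁ 1 (-1) 0
  have := h₁ 1 1 (-1)
  have := h₁ 1 2 0
  have := h₂ 1 0 0
  have := h₂ 0 0 1
  have := h₂ 1 1 0
  have := h₂ 1 0 1
  have := h₂ 1 0 (-1)
  have := h₂ 0 1 1
  have := h₂ 1 1 1
  have := h₂ 0 1 2
  norm_num at *
  grind

lemma aeval_of_skew_left_quadratic {p : MvPolynomial (Fin 3) ℂ} (hp : p.IsHomogeneous 2)
    (h : ∀ x y z : ℂ, aeval ![y, x, z] p = -aeval ![x, y, z] p) :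
    ∃ r s : ℂ, ∀ x y z : ℂ, aeval ![x, y, z] p = (x - y) * (r * (x + y) + s * z) := by
  obtain ⟨c, hc⟩ := exists_aeval_eq_of_isHomogeneous hp
  simp only [hc, Finset.sum_range_succ, Finset.sum_range_zero] at h ⊢
  refine ⟨c 2 0, c 1 0, fun x y z => ?_⟩
  have := h 1 0 0
  have := h 0 0 1
  have := h 1 1 0
  have := h 1 0 1
  norm_num at *
  grind

lemma aeval_of_skew_right_quadratic {p : MvPolynomial (Fin 3) ℂ} (hp : p.IsHomogeneous 2)
    (h : ∀ x y z : ℂ, aeval ![x, z, y] p = -aeval ![x, y, z] p) :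
    ∃ r s : ℂ, ∀ x y z : ℂ, aeval ![x, y, z] p = (y - z) * (r * (y + z) + s * x) := by
  obtain ⟨c, hc⟩ := exists_aeval_eq_of_isHomogeneous hp
  simp only [hc, Finset.sum_range_succ, Finset.sum_range_zero] at h ⊢
  refine ⟨c 0 2, c 1 1, fun x y z => ?_⟩
  have := h 0 1 0
  have := h 1 0 0
  have := h 0 1 1
  have := h 1 0 1
  norm_num at *
  grind

lemma aeval_of_skew_left_linear {p : MvPolynomial (Fin 3) ℂ} (hp : p.IsHomogeneous 1)
    (h : ∀ x y z : ℂ, aeval ![y, x, z] p = -aeval ![x, y, z] p) :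
    ∃ r : ℂ, ∀ x y z : ℂ, aeval ![x, y, z] p = r * (x - y) := by
  obtain ⟨c, hc⟩ := exists_aeval_eq_of_isHomogeneous hp
  simp only [hc, Finset.sum_range_succ, Finset.sum_range_zero] at h ⊢
  refine ⟨c 1 0, fun x y z => ?_⟩
  have := h 1 0 0
  have := h 0 0 1
  norm_num at *
  grind

lemma aeval_of_skew_right_linear {p : MvPolynomial (Fin 3) ℂ} (hp : p.IsHomogeneous 1)
    (h : ∀ x y z : ℂ, aeval ![x, z, y] p = -aeval ![x, y, z] p) :
    ∃ r : ℂ, ∀ x y z : ℂ, aeval ![x, y, z] p = r * (y - z) := by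
  obtain ⟨c, hc⟩ := exists_aeval_eq_of_isHomogeneous hp
  simp only [hc, Finset.sum_range_succ, Finset.sum_range_zero] at h ⊢
  refine ⟨c 0 1, fun x y z => ?_⟩
  have := h 1 0 0
  have := h 0 0 1
  norm_num at *
  grind

/-- The `2`-cochains of weight zero vanishing on `(L, L)`, with `(L, M) ↦ s λ₁` and
`(Y, Y) ↦ t (λ₁ - λ₂)`. -/
noncomputable def SVbase (s t : ℂ) : SVRaw 2 := fun a =>
  match a 0, a 1 with
  | L, M => C s * X 0
  | M, L => -(C s * X 1)
  | Y, Y => C t * (X 0 - X 1)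
  | _, _ => 0

lemma SVbase_mem_SVCochain (s t : ℂ) : SVbase s t ∈ SVCochain 2 := by
  refine mem_SVCochain_two fun a b x y => ?_
  cases a <;> cases b <;> simp [SVbase]
  ring

lemma aeval_SVPhi {R : Type*} [CommRing R] [Algebra ℂ R] (a b d : SVGen) (x y z : R) :
    aeval ![x, y, z] (SVPhi ![a, b, d]) =
      if a = L ∧ b = L ∧ d = L then (x - y) * (x - z) * (y - z) else 0 := by
  simp only [SVPhi, Matrix.vecCons_inj, and_true]
  split_ifs <;> simp

lemma SVPhi_mem_SVCochain : SVPhi ∈ SVCochain 3 := by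
  refine mem_SVCochain_three (fun a b d x y z => ?_) fun a b d x y z => ?_ <;>
    rw [aeval_SVPhi, aeval_SVPhi] <;> split_ifs <;> first | tauto | ring

lemma SVd_SVPhi : SVd SVPhi = 0 := by
  funext s
  obtain ⟨a, b, d, e, rfl⟩ : ∃ a b d e, s = ![a, b, d, e] := ⟨_, _, _, _, eq_vec_four s⟩
  refine ext_aeval_four fun x y z t => ?_
  rw [aeval_SVd_three]
  simp only [aeval_SVPhi, Pi.zero_apply, map_zero]
  cases a <;> cases b <;> cases d <;> cases e <;> simp [SVbrk, SVfactor]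
  ring

lemma aeval_SVd_SVbase (s t : ℂ) (x y z : ℂ) :
    aeval ![x, y, z] (SVd (SVbase s t) ![L, L, M]) = (x - y) * (-s * (x + y) + -s * z) ∧
    aeval ![x, y, z] (SVd (SVbase s t) ![L, Y, Y]) = (y - z) * (t * (y + z) + s * x) := by
  simp [aeval_SVd_two, SVbase, SVbrk, SVfactor, -coe_aeval_eq_eval]
  constructor <;> ring

lemma exists_eq_smul_SVPhi_add {u : SVRaw 3} (hu : u ∈ SVCochain 3) (hd : SVd u = 0)
    (hhom : ∀ (a : Fin 3 → SVGen) (n : ℕ), ∑ k, SVwt (a k) = n → (u a).IsHomogeneous n)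
    (hzero : ∀ a : Fin 3 → SVGen, (∀ n : ℕ, ∑ k, SVwt (a k) ≠ n) → u a = 0) :
    ∃ r s t : ℂ, u = r • SVPhi + SVd (SVbase s t) := by
  have hleft (a b d : SVGen) (x y z : ℂ) := SVCochain.aeval_swap_left hu a b d x y z
  have hright (a b d : SVGen) (x y z : ℂ) := SVCochain.aeval_swap_right hu a b d x y z
  obtain ⟨r, hLLL⟩ := aeval_of_alternating_cubic (hhom ![L, L, L] 3
    (by simp [Fin.sum_univ_three, SVwt]; norm_num)) (hleft L L L) (hright L L L)
  obtain ⟨a, b, hLLM⟩ := aeval_of_skew_left_quadratic (hhom ![L, L, M] 2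
    (by simp [Fin.sum_univ_three, SVwt]; norm_num)) (hleft L L M)
  obtain ⟨t, s, hLYY⟩ := aeval_of_skew_right_quadratic (hhom ![L, Y, Y] 2
    (by simp [Fin.sum_univ_three, SVwt]; norm_num)) (hright L Y Y)
  obtain ⟨p, hLMM⟩ := aeval_of_skew_right_linear (hhom ![L, M, M] 1
    (by simp [Fin.sum_univ_three, SVwt])) (hright L M M)
  obtain ⟨q, hYYM⟩ := aeval_of_skew_left_linear (hhom ![Y, Y, M] 1
    (by simp [Fin.sum_univ_three, SVwt]; norm_num)) (hleft Y Y M)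
  have hLLYY (x y z w : ℂ) := aeval_SVd_three u L L Y Y x y z w
  have hLYYM (x y z w : ℂ) := aeval_SVd_three u L Y Y M x y z w
  simp only [hd, SVbrk, hleft L M L, hleft L Y Y, hright L L M, hLLM, hLYY,
    hleft Y M Y, hright Y Y M, hYYM, hleft L M M, hLMM, SVfactor] at hLLYY hLYYM
  have e1 := hLLYY 1 0 1 0
  have e2 := hLLYY 1 0 2 0
  have e3 := hLYYM 0 1 0 0
  have e4 := hLYYM 0 1 0 1
  simp only [map_zero, Pi.zero_apply, Algebra.algebraMap_self, RingHom.id_apply] at e1 e2 e3 e4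
  have hb : b = -s := by linear_combination e2 / 2 - e1
  have ha : a = -s := by linear_combination e1 - hb
  have hq : q = 0 := by linear_combination -e4 / 2
  have hp : p = 0 := by linear_combination -e3 - hq
  have half (a : Fin 3 → SVGen) (m : ℕ) (h : ∑ k, SVwt (a k) = (2 * m + 1) / 2) : u a = 0 := by
    refine hzero a fun n hn => ?_
    rw [hn, eq_div_iff two_ne_zero] at h
    have : n * 2 = 2 * m + 1 := by exact_mod_cast h
    omega
  have hLLY : u ![L, L, Y] = 0 := half _ 2 (by simp [Fin.sum_univ_three, SVwt]; norm_num)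
  have hLYM : u ![L, Y, M] = 0 := half _ 1 (by simp [Fin.sum_univ_three, SVwt]; norm_num)
  have hYYY : u ![Y, Y, Y] = 0 := half _ 1 (by simp [Fin.sum_univ_three, SVwt]; norm_num)
  have hYMM : u ![Y, M, M] = 0 := half _ 0 (by simp [Fin.sum_univ_three, SVwt])
  have hMMM (x y z : ℂ) : aeval ![x, y, z] (u ![M, M, M]) = 0 := by
    obtain ⟨c, hc⟩ := exists_aeval_eq_of_isHomogeneous (hhom ![M, M, M] 0
      (by simp [Fin.sum_univ_three, SVwt]))
    have h := hleft M M M 0 0 0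
    simp only [hc, zero_add, Finset.sum_range_one, tsub_zero, pow_zero, mul_one] at h ⊢
    exact self_eq_neg.mp h
  have hbase := aeval_SVd_two (R := ℂ) (SVbase s t)
  refine ⟨r, s, t, sub_eq_zero.mp (SVCochain.eq_zero_of_sorted (sub_mem hu (add_mem
    (Submodule.smul_mem _ r SVPhi_mem_SVCochain) (SVd_mem_SVCochain_three _)))
    ?_ ?_ ?_ ?_ ?_ ?_ ?_ ?_ ?_ ?_)⟩ <;>
  refine ext_aeval_three fun x y z => ?_ <;>
  simp only [Pi.sub_apply, Pi.add_apply, Pi.smul_apply, map_sub, map_add, map_smul, map_zero,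
    aeval_SVPhi, (aeval_SVd_SVbase s t x y z).1, (aeval_SVd_SVbase s t x y z).2,
    hLLL, hLLM, hLYY, hLMM, hYYM, ha, hb, hp, hq, hLLY, hLYM, hYYY, hYMM, hMMM] <;>
  simp [hbase, SVbase, SVbrk, SVfactor]

lemma SVPhi_notMem_SVcoboundaries : SVPhi ∉ SVcoboundaries 3 := by
  rintro ⟨β, hβ, h⟩
  have hval := aeval_SVd_two β L L L (-1 : ℂ) 1 0
  have hd : SVd β = SVPhi := h
  have h₀ := SVCochain.aeval_swap_two hβ L L (0 : ℂ) 0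
  have h₁ := SVCochain.aeval_swap_two hβ L L (-1 : ℂ) 1
  rw [hd, aeval_SVPhi] at hval
  simp only [SVbrk, SVfactor, Algebra.algebraMap_self, RingHom.id_apply, neg_add_cancel, add_zero,
    h₁, self_eq_neg.mp h₀, and_self, if_true] at hval
  norm_num at hval

lemma exists_sub_smul_SVPhi_mem_SVcoboundaries {γ : SVRaw 3} (hγ : γ ∈ SVcocycles 3) :
    ∃ r : ℂ, γ - r • SVPhi ∈ SVcoboundaries 3 := by
  classical
  obtain ⟨hc, hd⟩ := hγ
  replace hd : SVd γ = 0 := LinearMap.mem_ker.mp hd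
  set δ : ℂ → ℂ := fun x => if x = 0 then 1 else 0 with hδ
  have hd' : SVd (SVscale δ γ) = 0 := by
    rw [← SVscale_d, hd]
    funext a
    exact map_zero _
  obtain ⟨r, s, t, h⟩ := exists_eq_smul_SVPhi_add (SVscale_mem_SVCochain δ hc) hd'
    (fun a n hn => isHomogeneous_degScale (fun m hm => by
      simp [hδ, hn, sub_eq_zero, hm]) _)
    (fun a hn => degScale_eq_zero (fun m => by simp [hδ, sub_eq_zero, (hn m).symm]) _)
  have hsplit := SVscale_add_scale (f := δ) (g := fun x => x⁻¹ * id x)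
    (fun x => by by_cases hx : x = 0 <;> simp [hδ, hx]) γ
  rw [← SVscale_scale, ← SVd_SVtau hc hd, SVscale_d, h] at hsplit
  have hlin (c : SVRaw 2) : SVdLin 2 c = SVd c := rfl
  refine ⟨r, Submodule.mem_map.mpr ⟨SVbase s t + SVscale Inv.inv (SVtau γ),
    add_mem (SVbase_mem_SVCochain s t) (SVscale_mem_SVCochain _ (SVtau_mem_SVCochain hc)), ?_⟩⟩
  rw [map_add, hlin, hlin, eq_sub_iff_add_eq]
  refine Eq.trans ?_ hsplit
  abel

/-- `H̃³(SV,ℂ) = ℂΦ` is one-dimensional: `Φ` is a `3`-cocycle,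
it is not a `3`-coboundary, and modulo coboundaries every `3`-cocycle is a
scalar multiple of `Φ`. -/
theorem statement7 :
    SVPhi ∈ SVcocycles 3 ∧
    SVPhi ∉ SVcoboundaries 3 ∧
    (∀ γ : SVRaw 3, γ ∈ SVcocycles 3 → ∃ c : ℂ, γ - c • SVPhi ∈ SVcoboundaries 3) ∧
    Module.finrank ℂ (SVbasicH 3) = 1 := by
  have hΦ : SVPhi ∈ SVcocycles 3 := ⟨SVPhi_mem_SVCochain, SVd_SVPhi⟩
  refine ⟨hΦ, SVPhi_notMem_SVcoboundaries,
    fun γ => exists_sub_smul_SVPhi_mem_SVcoboundaries, ?_⟩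
  change Module.finrank ℂ
    (SVcocycles 3 ⧸ Submodule.comap (SVcocycles 3).subtype (SVcoboundaries 3)) = 1
  refine finrank_eq_one (Submodule.Quotient.mk ⟨SVPhi, hΦ⟩) ?_ fun γ => ?_
  · rw [ne_eq, Submodule.Quotient.mk_eq_zero]
    exact SVPhi_notMem_SVcoboundaries
  · induction γ using Submodule.Quotient.induction_on with | H γ
    obtain ⟨r, hr⟩ := exists_sub_smul_SVPhi_mem_SVcoboundaries γ.2
    refine ⟨r, Eq.symm ?_⟩
    rw [← Submodule.Quotient.mk_smul, Submodule.Quotient.eq]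
    exact hr

end SVCA
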